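/- Let h : ℝ^n → ℝ be a smooth function, and suppose that for each t ∈ [0,1] the map ψ_t(x) = x + t ∇h(x) is a bijection of ℝ^n whose differential I + t ∇²h(x) is invertible for all x. Let g : [0,1] × ℝ^n → ℝ be defined by g(t, ψ_t(x)) = h(x) + (t/2)|∇h(x)|². Then the spatial Hessian of g satisfies ∇²g(t, ψ_t(x)) = ∇²h(x) · (I + t ∇²h(x))⁻¹ for all t ∈ [0,1] and x ∈ ℝ^n. -/

import Mathlib

noncomputable section

abbrev Eu (n : ℕ) : Type := EuclideanSpace ℝ (Fin n)

open InnerProductSpace in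
theorem ContDiff.gradient_of_infty {E : Type*} [NormedAddCommGroup E] [InnerProductSpace ℝ E]
    [CompleteSpace E] {h : E → ℝ} (hh : ContDiff ℝ (⊤ : ℕ∞) h) :
    ContDiff ℝ 1 (gradient h) :=
  (toDual ℝ E).symm.toContinuousLinearEquiv.contDiff.comp
    (hh.fderiv_right (m := 1) (by norm_cast))

/-- If `f y = x` and the derivative of `f` at `y` is the inverse of `1 + t • ∇²h x`, then
`z ↦ (h + t / 2 * ‖∇h‖ ^ 2) (f z)` has gradient `∇h x` at `y`. -/
theorem hasGradientAt_comp_of_hasFDerivAt_symm {E : Type*} [NormedAddCommGroup E]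
    [InnerProductSpace ℝ E] [CompleteSpace E] {h : E → ℝ} {t : ℝ} {f : E → E} {x y : E}
    {A : E ≃L[ℝ] E} (hfy : f y = x) (hh : DifferentiableAt ℝ h x)
    (hd : DifferentiableAt ℝ (gradient h) x)
    (hA : (A : E →L[ℝ] E) = ContinuousLinearMap.id ℝ E + t • fderiv ℝ (gradient h) x)
    (hf : HasFDerivAt f (A.symm : E →L[ℝ] E) y) :
    HasGradientAt (fun z => h (f z) + (t / 2) * ‖gradient h (f z)‖ ^ 2) (gradient h x) y := by
  subst hfy
  have h1 := hh.hasGradientAt.hasFDerivAt.add (hd.hasFDerivAt.norm_sq.const_mul (t / 2))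
  rw [hasGradientAt_iff_hasFDerivAt]
  refine (h1.comp y hf).congr_fderiv ?_
  ext v
  have hv : A.symm v + t • fderiv ℝ (gradient h) (f y) (A.symm v) = v := by
    simpa using (DFunLike.congr_fun hA (A.symm v)).symm
  conv_rhs => rw [← hv]
  simp
  ring

/-- Hessian formula along characteristics: if `h` is smooth and, for each `t ∈ [0,1]`, the map
`ψ_t(x) = x + t∇h(x)` is a bijection with invertible differential `I + t∇²h(x)`, and `g`
satisfies `g(t, ψ_t(x)) = h(x) + (t/2)|∇h(x)|²`, then the spatial Hessian of `g` satisfies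
`∇²g(t, ψ_t(x)) = ∇²h(x)·(I + t∇²h(x))⁻¹`. -/
theorem hessian_along_characteristics (n : ℕ) (h : Eu n → ℝ) (hh : ContDiff ℝ (⊤ : ℕ∞) h)
    (ψ : ℝ → Eu n → Eu n) (hψ : ∀ t x, ψ t x = x + t • gradient h x)
    (hbij : ∀ t ∈ Set.Icc (0 : ℝ) 1, Function.Bijective (ψ t))
    (hinv : ∀ t ∈ Set.Icc (0 : ℝ) 1, ∀ x : Eu n,
      Function.Bijective (fun v => v + t • fderiv ℝ (gradient h) x v))
    (g : ℝ → Eu n → ℝ)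
    (hg : ∀ t ∈ Set.Icc (0 : ℝ) 1, ∀ x : Eu n,
      g t (ψ t x) = h x + (t / 2) * ‖gradient h x‖ ^ 2) :
    ∀ t ∈ Set.Icc (0 : ℝ) 1, ∀ x : Eu n,
      fderiv ℝ (gradient (g t)) (ψ t x) =
        (fderiv ℝ (gradient h) x).comp
          (ContinuousLinearMap.inverse
            (ContinuousLinearMap.id ℝ (Eu n) + t • fderiv ℝ (gradient h) x)) := by
  intro t ht x
  have hd := hh.gradient_of_infty
  have hψ' : ψ t = fun x => x + t • gradient h x := funext (hψ t)
  obtain ⟨f, hleft, hright⟩ := Function.bijective_iff_has_inverse.mp (hbij t ht)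
  have key (z : Eu n) : ∃ A : Eu n ≃L[ℝ] Eu n,
      (A : Eu n →L[ℝ] Eu n) =
        ContinuousLinearMap.id ℝ (Eu n) + t • fderiv ℝ (gradient h) z ∧
      HasFDerivAt f (A.symm : Eu n →L[ℝ] Eu n) (ψ t z) := by
    have hb : Function.Bijective
        (ContinuousLinearMap.id ℝ (Eu n) + t • fderiv ℝ (gradient h) z) := hinv t ht z
    let A := ContinuousLinearEquiv.ofBijective _
      (LinearMap.ker_eq_bot.mpr hb.1) (LinearMap.range_eq_top.mpr hb.2)
    have hA : (A : Eu n →L[ℝ] Eu n) =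
        ContinuousLinearMap.id ℝ (Eu n) + t • fderiv ℝ (gradient h) z :=
      ContinuousLinearEquiv.coe_ofBijective _ _ _
    have hs : HasStrictFDerivAt (ψ t) (A : Eu n →L[ℝ] Eu n) z := by
      rw [hψ', hA]
      exact (hasStrictFDerivAt_id z).add
        ((hd.contDiffAt.hasStrictFDerivAt one_ne_zero).const_smul t)
    exact ⟨A, hA, (hs.to_local_left_inverse (.of_forall hleft)).hasFDerivAt⟩
  have hgt : g t = fun y => h (f y) + (t / 2) * ‖gradient h (f y)‖ ^ 2 := by
    funext y
    rw [← hg t ht, hright y]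
  have hgrad : gradient (g t) = gradient h ∘ f := by
    funext y
    obtain ⟨z, rfl⟩ := (hbij t ht).2 y
    obtain ⟨A, hA, hf⟩ := key z
    rw [hgt, Function.comp_apply, hleft z]
    exact (hasGradientAt_comp_of_hasFDerivAt_symm (hleft z)
      (hh.differentiable (by simp) z) (hd.differentiable one_ne_zero z) hA hf).gradient
  obtain ⟨A, hA, hf⟩ := key x
  have hdx : HasFDerivAt (gradient h) (fderiv ℝ (gradient h) x) (f (ψ t x)) := by
    rw [hleft x]
    exact (hd.differentiable one_ne_zero x).hasFDerivAt
  rw [hgrad, (hdx.comp _ hf).fderiv, ← hA, ContinuousLinearMap.inverse_equiv]
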